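/- For a partition λ and indeterminates a, b, q, the specialization of the super Schur function satisfies hs_λ(a, aq, aq², … ; b, bq, bq², …) = q^{n(λ)} ∏_{□∈λ} (a + b q^{c_□})/(1 - q^{h_□}), where hs_λ(x;y) = ∑_{μ⊆λ} s_μ(x) s_{λ'/μ'}(y). -/

import Mathlib

open Finset
open scoped Classical

section SchurDefs

variable {A : Type*} [CommRing A]

/-- The complete homogeneous symmetric polynomial `h_k` evaluated at `w 0, …, w (N-1)`:
the sum of all monomials of total degree `k`. -/
noncomputable def completeHomogeneous (N : ℕ) (w : Fin N → A) (k : ℕ) : A :=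
  ∑ d ∈ Finset.Nat.antidiagonalTuple N k, ∏ i, w i ^ d i

/-- `h_z` for an integer index, with `h_z = 0` for `z < 0`. -/
noncomputable def completeHomogeneousZ (N : ℕ) (w : Fin N → A) (z : ℤ) : A :=
  if 0 ≤ z then completeHomogeneous N w z.toNat else 0

/-- The skew Schur polynomial `s_{λ/μ}` in the variables `w 0, …, w (N-1)`, defined by
the Jacobi–Trudi determinant `det(h_{λ_i - μ_j - i + j})`.  Partitions are given as
(weakly decreasing) tuples `Fin r → ℕ`, padded by zeros. -/
noncomputable def skewSchur (N r : ℕ) (w : Fin N → A) (lam mu : Fin r → ℕ) : A :=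
  Matrix.det (Matrix.of fun i j : Fin r =>
    completeHomogeneousZ N w ((lam i : ℤ) - (mu j : ℤ) - (i : ℤ) + (j : ℤ)))

/-- The conjugate (transpose) partition, as a tuple of length `c`:
`λ'_j = #{i : λ_i > j}` (0-indexed `j`). -/
def conjTuple (r : ℕ) (lam : Fin r → ℕ) (c : ℕ) : Fin c → ℕ :=
  fun j => (Finset.univ.filter fun i : Fin r => (j : ℕ) < lam i).card

/-- The super Schur function `hs_λ(x; y) = ∑_{μ ⊆ λ} s_μ(x) s_{λ'/μ'}(y)`, evaluated at
finitely many variables `x 0, …, x (Nx-1)` and `y 0, …, y (Ny-1)`. -/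
noncomputable def superSchur (Nx Ny r : ℕ) (x : Fin Nx → A) (y : Fin Ny → A)
    (lam : Fin r → ℕ) : A :=
  ∑ mu ∈ (Fintype.piFinset fun i : Fin r => Finset.range (lam i + 1)).filter
      (fun mu => Antitone mu),
    skewSchur Nx r x mu 0 * skewSchur Ny r y (conjTuple r lam r) (conjTuple r mu r)

end SchurDefs

/-- The coefficient field: rational functions in the two indeterminates `a` and `b`. -/
noncomputable abbrev FF : Type := FractionRing (MvPolynomial (Fin 2) ℚ)

/-- `a`, `b` and `q` inside the field of formal Laurent series `FF((q))`. -/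
noncomputable def aL : LaurentSeries FF :=
  HahnSeries.C (algebraMap (MvPolynomial (Fin 2) ℚ) FF (MvPolynomial.X 0))

noncomputable def bL : LaurentSeries FF :=
  HahnSeries.C (algebraMap (MvPolynomial (Fin 2) ℚ) FF (MvPolynomial.X 1))

noncomputable def qL : LaurentSeries FF := HahnSeries.single (1 : ℤ) (1 : FF)

lemma cb_step1 {R : Type*} [CommRing R] {n m : ℕ} (A : Matrix (Fin n) (Fin m) R)
    (B : Matrix (Fin m) (Fin n) R) :
    (A * B).det = ∑ f : Fin n → Fin m, (∏ i, A i (f i)) * (B.submatrix f id).det := by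
  have h : (A * B) = fun i => ∑ k, A i k • B k := by
    ext i j
    simp [Matrix.mul_apply, Finset.sum_apply]
  have h2 := (Matrix.detRowAlternating (R := R) (n := Fin n)).toMultilinearMap.map_sum
    (fun i (k : Fin m) => A i k • B k)
  rw [h]
  refine h2.trans (Finset.sum_congr rfl fun f _ => ?_)
  exact (Matrix.detRowAlternating (R := R) (n := Fin n)).toMultilinearMap.map_smul_univ _ _

lemma strictAnti_eq_of_comp_perm {n m : ℕ} {k k' : Fin n → Fin m} (hk : StrictAnti k)
    (hk' : StrictAnti k') (s s' : Equiv.Perm (Fin n)) (h : k ∘ s = k' ∘ s') : k = k' := by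
  have h1 : StrictMono (k ∘ Fin.revPerm) := fun a b hab => hk (by simpa using hab)
  have h2 : StrictMono (k' ∘ Fin.revPerm) := fun a b hab => hk' (by simpa using hab)
  have h3 : Set.range (k ∘ Fin.revPerm) = Set.range (k' ∘ Fin.revPerm) := by
    have e1 := congrArg Set.range h
    simpa [EquivLike.range_comp] using e1
  have h4 := (h1.range_inj h2).1 h3
  funext i
  have := congrFun h4 (Fin.rev i)
  simpa using this

lemma cauchyBinet {R : Type*} [CommRing R] {n m : ℕ} (A : Matrix (Fin n) (Fin m) R)
    (B : Matrix (Fin m) (Fin n) R) :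
    (A * B).det = ∑ k ∈ univ.filter (fun k : Fin n → Fin m => StrictAnti k),
      (A.submatrix id k).det * (B.submatrix k id).det := by
  rw [cb_step1]
  have h1 : ∀ k : Fin n → Fin m, (A.submatrix id k).det * (B.submatrix k id).det =
      ∑ s : Equiv.Perm (Fin n), (∏ i, A i (k (s i))) * (B.submatrix (k ∘ s) id).det := by
    intro k
    rw [← Matrix.det_transpose, Matrix.det_apply', Finset.sum_mul]
    refine Finset.sum_congr rfl fun s _ => ?_
    have : (B.submatrix (k ∘ s) id) = (B.submatrix k id).submatrix s id := rfl
    rw [this, Matrix.det_permute]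
    simp
    ring
  simp_rw [h1]
  rw [← Finset.sum_product']
  symm
  rw [← Finset.sum_subset (Finset.subset_univ (univ.filter
    (fun f : Fin n → Fin m => Function.Injective f)))]
  · refine Finset.sum_bij (fun p _ => p.1 ∘ p.2) ?_ ?_ ?_ ?_
    · rintro ⟨k, s⟩ h
      simp only [mem_product, mem_filter, mem_univ, true_and, and_true] at h ⊢
      exact h.injective.comp s.injective
    · rintro ⟨k, s⟩ h ⟨k', s'⟩ h' e
      simp only [mem_product, mem_filter, mem_univ, true_and, and_true] at h h' e
      have := strictAnti_eq_of_comp_perm h h' s s' e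
      subst this
      congr 1
      ext i
      exact congrArg Fin.val (h.injective (congrFun e i))
    · intro f hf
      simp only [mem_filter, mem_univ, true_and] at hf
      refine ⟨(f ∘ (Tuple.sort f) ∘ Fin.revPerm, Fin.revPerm * (Tuple.sort f)⁻¹), ?_, ?_⟩
      · simp only [mem_product, mem_filter, mem_univ, true_and, and_true]
        have : StrictMono (f ∘ Tuple.sort f) :=
          (Tuple.monotone_sort f).strictMono_of_injective (hf.comp (Equiv.injective _))
        intro a b hab
        exact this (by simpa using hab)
      · ext i; simp
    · rintro ⟨k, s⟩ h
      rfl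
  · intro f _ hf
    simp only [mem_filter, mem_univ, true_and] at hf
    simp only [Function.Injective, not_forall] at hf
    obtain ⟨i, j, e, hij⟩ := hf
    rw [Matrix.det_zero_of_row_eq hij, mul_zero]
    ext l; simp [e]

lemma conj_le (n : ℕ) (lam : Fin n → ℕ) (j : Fin n) : conjTuple n lam n j ≤ n := by
  unfold conjTuple
  exact (Finset.card_le_univ _).trans (by simp)

lemma lt_conj_iff {n : ℕ} {lam : Fin n → ℕ} (h : Antitone lam) (i j : Fin n) :
    (i : ℕ) < conjTuple n lam n j ↔ (j : ℕ) < lam i := by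
  unfold conjTuple
  constructor
  · intro hi
    by_contra hj
    have : (univ.filter fun i : Fin n => (j : ℕ) < lam i) ⊆ Finset.Iio i := by
      intro k hk
      simp only [mem_filter, mem_univ, true_and, mem_Iio] at hk ⊢
      by_contra hki
      have := h (not_lt.1 hki)
      omega
    have := Finset.card_le_card this
    simp at this
    omega
  · intro hj
    have : Finset.Iic i ⊆ (univ.filter fun i : Fin n => (j : ℕ) < lam i) := by
      intro k hk
      simp only [mem_filter, mem_univ, true_and, mem_Iic] at hk ⊢
      have := h hk
      omega
    have := Finset.card_le_card this
    simp at this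
    omega

/-- Positions of the vertical/horizontal steps of the boundary of a partition in an `n × n` box. -/
def posFun (n : ℕ) (lam : Fin n → ℕ) : Fin n ⊕ Fin n → ℕ :=
  Sum.elim (fun i => lam i + (n - 1 - i)) (fun j => n + j - conjTuple n lam n j)

lemma conj_antitone (n : ℕ) (lam : Fin n → ℕ) : Antitone (conjTuple n lam n) := by
  intro a b hab
  unfold conjTuple
  apply Finset.card_le_card
  intro k hk
  simp only [mem_filter, mem_univ, true_and] at hk ⊢
  have : (a : ℕ) ≤ b := hab
  omega

lemma posFun_inl_lt {n : ℕ} {lam : Fin n → ℕ} (h : Antitone lam) {i k : Fin n} :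
    posFun n lam (Sum.inl k) < posFun n lam (Sum.inl i) ↔ i < k := by
  simp only [posFun, Sum.elim_inl, Fin.lt_def]
  rcases lt_trichotomy i k with hh | hh | hh
  · have := h hh.le
    have : (i : ℕ) < k := hh
    omega
  · subst hh; simp
  · have := h hh.le
    have : (k : ℕ) < i := hh
    omega

lemma posFun_inr_lt {n : ℕ} {lam : Fin n → ℕ} {i k : Fin n} :
    posFun n lam (Sum.inr k) < posFun n lam (Sum.inr i) ↔ k < i := by
  simp only [posFun, Sum.elim_inr, Fin.lt_def]
  have h1 := conj_le n lam i
  have h2 := conj_le n lam k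
  rcases lt_trichotomy i k with hh | hh | hh
  · have := conj_antitone n lam hh.le
    have : (i : ℕ) < k := hh
    omega
  · subst hh; simp
  · have := conj_antitone n lam hh.le
    have : (k : ℕ) < i := hh
    omega

lemma posFun_inr_lt_inl {n : ℕ} {lam : Fin n → ℕ} (h : Antitone lam) {i j : Fin n} :
    posFun n lam (Sum.inr j) < posFun n lam (Sum.inl i) ↔ (j : ℕ) < lam i := by
  simp only [posFun, Sum.elim_inr, Sum.elim_inl]
  have := lt_conj_iff h i j
  have h2 := conj_le n lam j
  omega

lemma posFun_inr_ne_inl {n : ℕ} {lam : Fin n → ℕ} (h : Antitone lam) {i j : Fin n} :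
    posFun n lam (Sum.inr j) ≠ posFun n lam (Sum.inl i) := by
  simp only [posFun, Sum.elim_inr, Sum.elim_inl]
  have := lt_conj_iff h i j
  have h2 := conj_le n lam j
  omega

lemma posFun_lt {n : ℕ} {lam : Fin n → ℕ} (hn : ∀ i, lam i ≤ n) (x : Fin n ⊕ Fin n) :
    posFun n lam x < n + n := by
  rcases x with i | j
  · simp only [posFun, Sum.elim_inl]
    have := hn i
    omega
  · simp only [posFun, Sum.elim_inr]
    omega

lemma posFun_injective {n : ℕ} {lam : Fin n → ℕ} (h : Antitone lam) :
    Function.Injective (posFun n lam) := by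
  rintro (i | i) (j | j) e
  · rcases lt_trichotomy i j with hh | hh | hh
    · exact absurd e.symm ((posFun_inl_lt h).2 hh).ne
    · rw [hh]
    · exact absurd e ((posFun_inl_lt h).2 hh).ne
  · exact absurd e.symm (posFun_inr_ne_inl h)
  · exact absurd e (posFun_inr_ne_inl h)
  · rcases lt_trichotomy i j with hh | hh | hh
    · exact absurd e (posFun_inr_lt.2 hh).ne
    · rw [hh]
    · exact absurd e.symm (posFun_inr_lt.2 hh).ne

/-- The bijection between steps and positions. -/
noncomputable def posEquiv (n : ℕ) (lam : Fin n → ℕ) (h : Antitone lam) (hn : ∀ i, lam i ≤ n) :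
    Fin n ⊕ Fin n ≃ Fin (n + n) :=
  Equiv.ofBijective (fun x => ⟨posFun n lam x, posFun_lt hn x⟩) (by
    rw [Fintype.bijective_iff_injective_and_card]
    refine ⟨fun x y e => posFun_injective h (by simpa using e), by simp⟩)

lemma posEquiv_val {n : ℕ} {lam : Fin n → ℕ} (h : Antitone lam) (hn : ∀ i, lam i ≤ n)
    (x : Fin n ⊕ Fin n) : (posEquiv n lam h hn x : ℕ) = posFun n lam x := rfl

lemma sum_conj {n : ℕ} {lam : Fin n → ℕ} (hn : ∀ i, lam i ≤ n) :
    ∑ j, conjTuple n lam n j = ∑ i, lam i := by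
  unfold conjTuple
  simp_rw [Finset.card_filter]
  rw [Finset.sum_comm]
  refine Finset.sum_congr rfl fun i _ => ?_
  rw [← Finset.card_filter]
  have h := Fin.card_filter_val_lt (n := n) (m := lam i)
  rw [min_eq_right (hn i)] at h
  convert h using 2

lemma posFun_removeBox {n : ℕ} {lam : Fin n → ℕ} (h : Antitone lam) (hn : ∀ i, lam i ≤ n)
    (i : Fin n) (hi : 0 < lam i) (hmax : ∀ k, i < k → lam k = 0) (j : Fin n)
    (hj : (j : ℕ) = lam i - 1)
    (h' : Antitone (Function.update lam i (lam i - 1))) (x : Fin n ⊕ Fin n) :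
    posFun n (Function.update lam i (lam i - 1)) x =
      posFun n lam (Equiv.swap (Sum.inl i) (Sum.inr j) x) := by
  have c1 : conjTuple n lam n j = i + 1 := by
    have a1 := (lt_conj_iff h i j).2 (by omega)
    have a2 := conj_le n lam j
    by_contra hne
    have hlt : (i : ℕ) + 1 < n := by omega
    have a3 := (lt_conj_iff h ⟨i + 1, hlt⟩ j).1 (by simp; omega)
    rw [hmax ⟨i + 1, hlt⟩ (by simp [Fin.lt_def])] at a3
    omega
  have c2 : conjTuple n (Function.update lam i (lam i - 1)) n j = i := by
    have a1 := (lt_conj_iff h' i j)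
    simp only [Function.update_self] at a1
    rcases Nat.eq_zero_or_pos (i : ℕ) with h0 | h0
    · omega
    · have hlt : (i : ℕ) - 1 < n := by omega
      have a2 := (lt_conj_iff h' ⟨i - 1, hlt⟩ j)
      have ne : (⟨i - 1, hlt⟩ : Fin n) ≠ i := by
        intro e
        have := congrArg Fin.val e
        simp at this
        omega
      rw [Function.update_of_ne ne] at a2
      have a3 : lam i ≤ lam ⟨i - 1, hlt⟩ := h (by simp [Fin.le_def])
      simp only at a2
      omega
  have hin := hn i
  rcases x with k | l
  · by_cases hk : k = i
    · subst hk
      rw [Equiv.swap_apply_left]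
      simp only [posFun, Sum.elim_inl, Sum.elim_inr, Function.update_self, c1]
      omega
    · rw [Equiv.swap_apply_of_ne_of_ne (by simpa using hk) (by simp)]
      simp only [posFun, Sum.elim_inl, Function.update_of_ne hk]
  · by_cases hl : l = j
    · subst hl
      rw [Equiv.swap_apply_right]
      simp only [posFun, Sum.elim_inl, Sum.elim_inr, c2]
      omega
    · rw [Equiv.swap_apply_of_ne_of_ne (by simp) (by simpa using hl)]
      simp only [posFun, Sum.elim_inr]
      congr 1
      unfold conjTuple
      congr 1
      ext k
      simp only [mem_filter, mem_univ, true_and]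
      by_cases hk : k = i
      · subst hk
        rw [Function.update_self]
        have : (l : ℕ) ≠ j := fun e => hl (Fin.ext e)
        omega
      · rw [Function.update_of_ne hk]

lemma sign_posEquiv {n : ℕ} (s : ℕ) : ∀ (lam : Fin n → ℕ) (h : Antitone lam)
    (hn : ∀ i, lam i ≤ n) (h0 : Antitone (0 : Fin n → ℕ)) (hn0 : ∀ i, (0 : Fin n → ℕ) i ≤ n),
    ∑ i, lam i = s →
    Equiv.Perm.sign ((posEquiv n lam h hn).trans (posEquiv n 0 h0 hn0).symm) = (-1) ^ s := by
  induction s with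
  | zero =>
    intro lam h hn h0 hn0 hs
    have : lam = 0 := by
      funext i
      simp at hs
      exact hs i
    subst this
    simp
  | succ s ih =>
    intro lam h hn h0 hn0 hs
    have hne : (univ.filter fun i => 0 < lam i).Nonempty := by
      by_contra hc
      rw [Finset.not_nonempty_iff_eq_empty, Finset.filter_eq_empty_iff] at hc
      have : ∑ i, lam i = 0 := Finset.sum_eq_zero fun i _ => by
        have := hc (mem_univ i); omega
      omega
    obtain ⟨i, hi, hmax⟩ := Finset.exists_max_image _ id hne
    simp only [mem_filter, mem_univ, true_and, id] at hi hmax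
    have hmax' : ∀ k, i < k → lam k = 0 := by
      intro k hk
      by_contra hc
      exact absurd (hmax k (by omega)) (not_le.2 hk)
    have hin := hn i
    have h' : Antitone (Function.update lam i (lam i - 1)) := by
      intro a b hab
      by_cases ha : a = i
      · subst ha
        by_cases hb : b = a
        · subst hb; exact le_rfl
        · rw [Function.update_of_ne hb, hmax' b (lt_of_le_of_ne hab (Ne.symm hb))]
          exact Nat.zero_le _
      · rw [Function.update_of_ne ha]
        by_cases hb : b = i
        · subst hb
          rw [Function.update_self]
          have := h hab
          omega
        · rw [Function.update_of_ne hb]; exact h hab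
    have hle : ∀ k, Function.update lam i (lam i - 1) k ≤ lam k := by
      intro k
      by_cases hk : k = i
      · subst hk; rw [Function.update_self]; omega
      · rw [Function.update_of_ne hk]
    have hn' : ∀ k, Function.update lam i (lam i - 1) k ≤ n := fun k => (hle k).trans (hn k)
    have hs' : ∑ k, Function.update lam i (lam i - 1) k = s := by
      rw [Finset.sum_update_of_mem (mem_univ i)]
      have := Finset.add_sum_erase univ lam (mem_univ i)
      rw [← Finset.sdiff_singleton_eq_erase] at this
      omega
    have key := ih _ h' hn' h0 hn0 hs'
    set j : Fin n := ⟨lam i - 1, by omega⟩ with hjdef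
    have e1 : posEquiv n _ h' hn' =
        (Equiv.swap (Sum.inl i) (Sum.inr j)).trans (posEquiv n lam h hn) := by
      ext x
      rw [posEquiv_val, Equiv.trans_apply, posEquiv_val]
      exact posFun_removeBox h hn i hi hmax' j rfl h' x
    rw [e1, Equiv.trans_assoc, Equiv.Perm.sign_trans, Equiv.Perm.sign_swap (by simp)] at key
    rw [pow_succ, ← key]
    simp

lemma jacobi_minor {R ι κ : Type*} [CommRing R] [Fintype ι] [Fintype κ] [DecidableEq ι]
    [DecidableEq κ] (M N : Matrix (ι ⊕ κ) (ι ⊕ κ) R) (h : M * N = 1) :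
    M.det * N.toBlocks₂₂.det = M.toBlocks₁₁.det := by
  have h1 : M * Matrix.fromBlocks 1 N.toBlocks₁₂ 0 N.toBlocks₂₂ =
      Matrix.fromBlocks M.toBlocks₁₁ 0 M.toBlocks₂₁ 1 := by
    rw [← Matrix.fromBlocks_toBlocks M, ← Matrix.fromBlocks_toBlocks N,
      Matrix.fromBlocks_multiply, ← Matrix.fromBlocks_one, Matrix.fromBlocks_inj] at h
    conv_lhs => rw [← Matrix.fromBlocks_toBlocks M, Matrix.fromBlocks_multiply]
    rw [h.2.1, h.2.2.2]
    simp
  have h2 := congrArg Matrix.det h1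
  rw [Matrix.det_mul, Matrix.det_fromBlocks_zero₂₁, Matrix.det_fromBlocks_zero₁₂] at h2
  simpa using h2

/-- Convolution of two sequences indexed by integers and supported on the naturals. -/
def convZ {R : Type*} [CommRing R] (f g : ℤ → R) (z : ℤ) : R :=
  if 0 ≤ z then ∑ p ∈ antidiagonal z.toNat, f p.1 * g p.2 else 0

lemma conv_sum {R : Type*} [CommRing R] (f g : ℤ → R) (hf : ∀ z < 0, f z = 0)
    (hg : ∀ z < 0, g z = 0) (m r c : ℕ) (hr : r < m) :
    ∑ k : Fin m, f ((r : ℤ) - (k : ℕ)) * g (((k : ℕ) : ℤ) - c) = convZ f g ((r : ℤ) - c) := by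
  rw [Fin.sum_univ_eq_sum_range (fun k : ℕ => f ((r : ℤ) - k) * g ((k : ℤ) - c))]
  unfold convZ
  split_ifs with h
  · have hcr : c ≤ r := by omega
    have e : ((r : ℤ) - c).toNat = r - c := by omega
    rw [e, Finset.Nat.sum_antidiagonal_eq_sum_range_succ_mk]
    simp only
    conv_rhs => rw [← Finset.sum_range_reflect]
    have : ∀ k ∈ range m, k ∉ Finset.Ico c (r + 1) → f ((r : ℤ) - k) * g ((k : ℤ) - c) = 0 := by
      intro k _ hk2
      simp only [mem_Ico, not_and, not_lt] at hk2
      by_cases hck : c ≤ k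
      · rw [hf _ (by have := hk2 hck; omega), zero_mul]
      · rw [hg _ (by omega), mul_zero]
    rw [← Finset.sum_subset (s₁ := Finset.Ico c (r + 1)) _ this]
    · rw [Finset.sum_Ico_eq_sum_range]
      have e2 : r + 1 - c = (r - c).succ := by omega
      rw [e2]
      refine Finset.sum_congr rfl fun k hk => ?_
      simp only [mem_range] at hk
      congr 2 <;> omega
    · intro k hk
      simp only [mem_Ico, mem_range] at hk ⊢
      omega
  · refine Finset.sum_eq_zero fun k _ => ?_
    by_cases hck : c ≤ k
    · rw [hf _ (by omega), zero_mul]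
    · rw [hg _ (by omega), mul_zero]

lemma dual_jt {R : Type*} [CommRing R] (e h : ℤ → R) (he : ∀ z < 0, e z = 0)
    (hh : ∀ z < 0, h z = 0) (he0 : e 0 = 1)
    (hconv : ∀ z : ℤ, convZ e (fun z => (-1) ^ z.natAbs * h z) z = if z = 0 then 1 else 0)
    {n : ℕ} {lam mu : Fin n → ℕ} (hl : Antitone lam) (hln : ∀ i, lam i ≤ n)
    (hm : Antitone mu) (hmn : ∀ i, mu i ≤ n) :
    (Matrix.of fun i j : Fin n => e ((lam i : ℤ) - (mu j : ℤ) - (i : ℤ) + (j : ℤ))).det =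
    (Matrix.of fun i j : Fin n => h ((conjTuple n lam n i : ℤ) - (conjTuple n mu n j : ℤ)
      - (i : ℤ) + (j : ℤ))).det := by
  set E : Matrix (Fin (n + n)) (Fin (n + n)) R :=
    Matrix.of fun r c => e (((r : ℕ) : ℤ) - (c : ℕ)) with hE
  set H : Matrix (Fin (n + n)) (Fin (n + n)) R :=
    Matrix.of fun r c => (-1) ^ ((r : ℤ) - (c : ℕ)).natAbs * h (((r : ℕ) : ℤ) - (c : ℕ)) with hH
  have hEH : E * H = 1 := by
    ext r c
    rw [Matrix.mul_apply]
    have := conv_sum e (fun z => (-1) ^ z.natAbs * h z) he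
      (fun z hz => by simp [hh z hz]) (n + n) r c r.2
    rw [hconv] at this
    simp only [hE, hH, Matrix.of_apply]
    rw [this, Matrix.one_apply]
    congr 1
    rw [Fin.ext_iff, eq_iff_iff]
    omega
  have hEdet : E.det = 1 := by
    rw [Matrix.det_of_isLowerTriangular]
    · simp [hE, he0]
    · intro r c hrc
      have : r < c := hrc
      simp only [hE, Matrix.of_apply]
      apply he
      have : (r : ℕ) < c := this
      omega
  set sl := posEquiv n lam hl hln
  set sm := posEquiv n mu hm hmn
  have h0 : Antitone (0 : Fin n → ℕ) := fun _ _ _ => le_rfl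
  have hn0 : ∀ i, (0 : Fin n → ℕ) i ≤ n := fun _ => Nat.zero_le _
  set s0 := posEquiv n 0 h0 hn0
  have hmul : E.submatrix sl sm * H.submatrix sm sl = 1 := by
    rw [Matrix.submatrix_mul_equiv, hEH, Matrix.submatrix_one_equiv]
  have hJ := jacobi_minor _ _ hmul
  have hdet : (E.submatrix sl sm).det = (-1) ^ (∑ i, lam i) * (-1) ^ (∑ i, mu i) := by
    have e1 : E.submatrix sl sm = (E.submatrix sm sm).submatrix (sl.trans sm.symm) id := by
      ext x y; simp
    have e2 : sl.trans sm.symm = (sl.trans s0.symm).trans (sm.trans s0.symm).symm := by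
      ext x; simp
    rw [e1, Matrix.det_permute, Matrix.det_submatrix_equiv_self, hEdet, e2,
      Equiv.Perm.sign_trans, Equiv.Perm.sign_symm, sign_posEquiv _ lam hl hln h0 hn0 rfl,
      sign_posEquiv _ mu hm hmn h0 hn0 rfl]
    push_cast
    ring
  have h11 : (E.submatrix sl sm).toBlocks₁₁ =
      Matrix.of fun i j : Fin n => e ((lam i : ℤ) - (mu j : ℤ) - (i : ℤ) + (j : ℤ)) := by
    ext i j
    simp only [Matrix.toBlocks₁₁, Matrix.submatrix_apply, Matrix.of_apply, hE]
    congr 1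
    simp only [sl, sm, posEquiv_val, posFun, Sum.elim_inl]
    omega
  set D : Matrix (Fin n) (Fin n) R := Matrix.of fun i j : Fin n =>
    h ((conjTuple n lam n i : ℤ) - (conjTuple n mu n j : ℤ) - (i : ℤ) + (j : ℤ)) with hD
  have h22 : (H.submatrix sm sl).toBlocks₂₂ =
      Matrix.of fun i j : Fin n => (-1) ^ ((i : ℕ) + conjTuple n mu n i) *
        (Matrix.of (fun i j : Fin n => (-1) ^ ((j : ℕ) + conjTuple n lam n j) * D.transpose i j)) i j := by
    ext i j
    have b1 := conj_le n lam j
    have b2 := conj_le n mu i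
    have e1 : (posFun n mu (Sum.inr i) : ℤ) - (posFun n lam (Sum.inr j) : ℕ) =
      (conjTuple n lam n j : ℤ) - (conjTuple n mu n i : ℤ) - (j : ℤ) + (i : ℤ) := by
      simp only [posFun, Sum.elim_inr]
      omega
    simp only [Matrix.toBlocks₂₂, Matrix.submatrix_apply, Matrix.of_apply, hH, hD,
      Matrix.transpose_apply, sl, sm, posEquiv_val]
    rw [e1, ← mul_assoc, ← pow_add]
    congr 1
    apply neg_one_pow_congr
    simp only [Nat.even_iff]
    omega
  have hs : ((-1 : R)) ^ (∑ i, lam i) * (-1) ^ (∑ i, mu i) *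
      ((∏ i : Fin n, (-1) ^ ((i : ℕ) + conjTuple n mu n i)) *
        ∏ i : Fin n, (-1) ^ ((i : ℕ) + conjTuple n lam n i)) = 1 := by
    rw [Finset.prod_pow_eq_pow_sum, Finset.prod_pow_eq_pow_sum, Finset.sum_add_distrib,
      Finset.sum_add_distrib, sum_conj hln, sum_conj hmn, ← pow_add, ← pow_add, ← pow_add]
    apply Even.neg_one_pow
    rw [Nat.even_iff]; omega
  rw [h11, hdet, h22, Matrix.det_mul_column, Matrix.det_mul_row, Matrix.det_transpose,
    ← mul_assoc, ← mul_assoc, mul_assoc (_ * _) (∏ i, _) (∏ i, _), hs, one_mul] at hJ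
  exact hJ.symm

lemma det_zero_block {R : Type*} [CommRing R] {n : ℕ} (M : Matrix (Fin n) (Fin n) R) (i : Fin n)
    (h : ∀ r c, i ≤ r → c ≤ i → M r c = 0) : M.det = 0 := by
  rw [Matrix.det_apply']
  refine Finset.sum_eq_zero fun s _ => ?_
  obtain ⟨c, hc, hsc⟩ : ∃ c, c ≤ i ∧ i ≤ s c := by
    by_contra hcon
    push Not at hcon
    have := Finset.card_le_card_of_injOn (s := Finset.Iic i) (t := Finset.Iio i) s
      (fun c hc => by simpa using hcon c (by simpa using hc)) (s.injective.injOn)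
    simp at this
  have h0 : ∏ l, M (s l) l = 0 := Finset.prod_eq_zero (mem_univ c) (h _ _ hsc hc)
  rw [h0, mul_zero]

lemma strictAnti_gap {n m : ℕ} {k : Fin n → Fin m} (hk : StrictAnti k) (d : ℕ) :
    ∀ i j : Fin n, (i : ℕ) + d = j → (k j : ℕ) + d ≤ k i := by
  induction d with
  | zero =>
    intro i j h
    have : i = j := Fin.ext (by simpa using h)
    subst this; simp
  | succ d ih =>
    intro i j h
    have hlt : (i : ℕ) + d < n := by omega
    have a1 := ih i ⟨i + d, hlt⟩ rfl
    have a2 : k j < k ⟨i + d, hlt⟩ := hk (by simp [Fin.lt_def]; omega)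
    have a3 : (k j : ℕ) < k ⟨i + d, hlt⟩ := a2
    omega

lemma super_det {R : Type*} [CommRing R] (hx hy ey : ℤ → R) (hx0 : ∀ z < 0, hx z = 0)
    (he : ∀ z < 0, ey z = 0) (hh : ∀ z < 0, hy z = 0) (he0 : ey 0 = 1)
    (hconv : ∀ z : ℤ, convZ ey (fun z => (-1) ^ z.natAbs * hy z) z = if z = 0 then 1 else 0)
    {n : ℕ} {lam : Fin n → ℕ} (hl : Antitone lam) (hln : ∀ i, lam i ≤ n) :
    ∑ mu ∈ (Fintype.piFinset fun i : Fin n => Finset.range (lam i + 1)).filter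
      (fun mu => Antitone mu),
      (Matrix.of fun i j : Fin n =>
        hx ((mu i : ℤ) - (((0 : Fin n → ℕ) j : ℕ) : ℤ) - (i : ℤ) + (j : ℤ))).det *
      (Matrix.of fun i j : Fin n => hy ((conjTuple n lam n i : ℤ) - (conjTuple n mu n j : ℤ)
        - (i : ℤ) + (j : ℤ))).det =
    (Matrix.of fun i j : Fin n => convZ ey hx ((lam i : ℤ) - (i : ℤ) + (j : ℤ))).det := by
  set A : Matrix (Fin n) (Fin (n + n)) R := Matrix.of fun i k =>
    ey (((lam i + (n - 1 - i) : ℕ) : ℤ) - (k : ℕ)) with hA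
  set B : Matrix (Fin (n + n)) (Fin n) R := Matrix.of fun k j =>
    hx (((k : ℕ) : ℤ) - ((n - 1 - j : ℕ) : ℕ)) with hB
  have hAB : (Matrix.of fun i j : Fin n => convZ ey hx ((lam i : ℤ) - (i : ℤ) + (j : ℤ))) =
      A * B := by
    ext i j
    rw [Matrix.mul_apply]
    have := hln i
    have := conv_sum ey hx he hx0 (n + n) (lam i + (n - 1 - i)) (n - 1 - j) (by omega)
    simp only [hA, hB, Matrix.of_apply]
    rw [this]
    congr 1
    omega
  rw [hAB, cauchyBinet]
  refine Finset.sum_of_injOn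
    (fun mu i => ⟨(mu i + (n - 1 - i)) % (n + n), Nat.mod_lt _ (by have := i.pos; omega)⟩)
    ?_ ?_ ?_ ?_
  · intro mu hmu nu hnu e
    simp only [coe_filter, Fintype.mem_piFinset, mem_range, Set.mem_ofPred_eq] at hmu hnu
    funext i
    have a1 := congrArg Fin.val (congrFun e i)
    have a2 := hmu.1 i
    have a3 := hnu.1 i
    have a4 := hln i
    simp only at a1
    rw [Nat.mod_eq_of_lt (by omega), Nat.mod_eq_of_lt (by omega)] at a1
    omega
  · intro mu hmu
    simp only [coe_filter, Fintype.mem_piFinset, mem_range, Set.mem_ofPred_eq, mem_univ,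
      true_and] at hmu ⊢
    intro i j hij
    have a2 := hmu.1 i
    have a3 := hmu.1 j
    have a4 := hln i
    have a5 := hln j
    have a6 := hmu.2 hij.le
    have a7 : (i : ℕ) < j := hij
    rw [Fin.lt_def]
    simp only
    rw [Nat.mod_eq_of_lt (by omega), Nat.mod_eq_of_lt (by omega)]
    omega
  · intro k hk hkn
    simp only [mem_filter, mem_univ, true_and] at hk
    have hge : ∀ i : Fin n, n - 1 - i ≤ (k i : ℕ) := by
      intro i
      have := strictAnti_gap hk (n - 1 - i) i ⟨n - 1, by have := i.pos; omega⟩ (by simp; omega)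
      omega
    obtain ⟨i, hi⟩ : ∃ i, lam i < (k i : ℕ) - (n - 1 - i) := by
      by_contra hcon
      push Not at hcon
      apply hkn
      refine ⟨fun i => (k i : ℕ) - (n - 1 - i), ?_, ?_⟩
      · simp only [coe_filter, Fintype.mem_piFinset, mem_range, Set.mem_ofPred_eq]
        refine ⟨fun i => by have := hcon i; omega, ?_⟩
        intro i j hij
        have a7 : (i : ℕ) ≤ j := hij
        have := strictAnti_gap hk (j - i) i j (by omega)
        have := hge i
        have := hge j
        simp only
        omega
      · funext i
        apply Fin.ext
        have := hge i
        have := (k i).2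
        simp only
        rw [Nat.mod_eq_of_lt (by omega)]
        omega
    rw [det_zero_block _ i, zero_mul]
    intro r c hr hc
    simp only [Matrix.submatrix_apply, id, hA, Matrix.of_apply]
    apply he
    have a1 := hl hr
    have a2 : k i ≤ k c := hk.antitone hc
    have a3 : (k i : ℕ) ≤ k c := a2
    have a4 : (i : ℕ) ≤ r := hr
    omega
  · intro mu hmu
    simp only [mem_filter, Fintype.mem_piFinset, mem_range] at hmu
    have hmn : ∀ i, mu i ≤ n := fun i => by have := hmu.1 i; have := hln i; omega
    rw [← dual_jt ey hy he hh he0 hconv hl hln hmu.2 hmn, mul_comm]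
    have hmod : ∀ i : Fin n, (mu i + (n - 1 - i)) % (n + n) = mu i + (n - 1 - i) := fun i =>
      Nat.mod_eq_of_lt (by have := hmn i; omega)
    congr 2
    · ext i j
      simp only [Matrix.submatrix_apply, id, hA, Matrix.of_apply, hmod]
      congr 1
      omega
    · ext i j
      simp only [Matrix.submatrix_apply, id, hB, Matrix.of_apply, hmod, Pi.zero_apply]
      congr 1
      omega

section QSeries
variable {K : Type*} [Field K]

/-- `(q;q)_k`. -/
def qp (q : K) (k : ℕ) : K := ∏ t ∈ range k, (1 - q ^ (t + 1))

lemma qp_succ (q : K) (k : ℕ) : qp q (k + 1) = qp q k * (1 - q ^ (k + 1)) :=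
  Finset.prod_range_succ _ _

lemma qp_ne_zero {q : K} (hq1 : ∀ k : ℕ, q ^ (k + 1) ≠ 1) (k : ℕ) : qp q k ≠ 0 :=
  Finset.prod_ne_zero_iff.2 fun t _ => sub_ne_zero.2 (hq1 t).symm

/-- limit of complete homogeneous -/
def hN (a q : K) (k : ℕ) : K := a ^ k / qp q k
/-- limit of elementary -/
def eN (b q : K) (k : ℕ) : K := b ^ k * q ^ (k.choose 2) / qp q k
/-- super one-row -/
def gN (a b q : K) (k : ℕ) : K := (∏ t ∈ range k, (a + b * q ^ t)) / qp q k

/-- extension by zero -/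
def extZ (f : ℕ → K) (z : ℤ) : K := if 0 ≤ z then f z.toNat else 0

lemma extZ_neg (f : ℕ → K) (z : ℤ) (h : z < 0) : extZ f z = 0 := if_neg (by omega)
lemma extZ_nat (f : ℕ → K) (k : ℕ) : extZ f (k : ℤ) = f k := by simp [extZ]

lemma hN_succ {q : K} (hq1 : ∀ k : ℕ, q ^ (k + 1) ≠ 1) (a : K) (k : ℕ) :
    hN a q (k + 1) * (1 - q ^ (k + 1)) = a * hN a q k := by
  have h1 := qp_ne_zero hq1 k
  have h2 : 1 - q ^ (k + 1) ≠ 0 := sub_ne_zero.2 (hq1 k).symm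
  unfold hN
  rw [qp_succ, pow_succ]
  field_simp

lemma eN_succ {q : K} (hq1 : ∀ k : ℕ, q ^ (k + 1) ≠ 1) (b : K) (k : ℕ) :
    eN b q (k + 1) * (1 - q ^ (k + 1)) = b * q ^ k * eN b q k := by
  have h1 := qp_ne_zero hq1 k
  have h2 : 1 - q ^ (k + 1) ≠ 0 := sub_ne_zero.2 (hq1 k).symm
  unfold eN
  have e : (k + 1).choose 2 = k + k.choose 2 := by
    rw [Nat.choose_succ_succ' k 1, Nat.choose_one_right]
  rw [qp_succ, e, pow_add q, pow_succ b]
  field_simp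

lemma gN_succ {q : K} (hq1 : ∀ k : ℕ, q ^ (k + 1) ≠ 1) (a b : K) (k : ℕ) :
    gN a b q (k + 1) * (1 - q ^ (k + 1)) = (a + b * q ^ k) * gN a b q k := by
  have h1 := qp_ne_zero hq1 k
  have h2 : 1 - q ^ (k + 1) ≠ 0 := sub_ne_zero.2 (hq1 k).symm
  unfold gN
  rw [qp_succ, Finset.prod_range_succ]
  field_simp

lemma qbinomial {q : K} (hq1 : ∀ k : ℕ, q ^ (k + 1) ≠ 1) (a b : K) (k : ℕ) :
    ∑ p ∈ antidiagonal k, eN b q p.1 * hN a q p.2 = gN a b q k := by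
  induction k with
  | zero => simp [eN, hN, gN, qp]
  | succ k ih =>
    have h2 : 1 - q ^ (k + 1) ≠ 0 := sub_ne_zero.2 (hq1 k).symm
    apply mul_right_cancel₀ h2
    rw [gN_succ hq1, ← ih, Finset.sum_mul]
    have e1 : ∀ p ∈ antidiagonal (k + 1), eN b q p.1 * hN a q p.2 * (1 - q ^ (k + 1)) =
        eN b q p.1 * (hN a q p.2 * (1 - q ^ p.2)) +
        (eN b q p.1 * (1 - q ^ p.1)) * (q ^ p.2 * hN a q p.2) := by
      intro p hp
      rw [HasAntidiagonal.mem_antidiagonal] at hp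
      rw [← hp, pow_add]
      ring
    rw [Finset.sum_congr rfl e1, Finset.sum_add_distrib,
      Finset.Nat.sum_antidiagonal_succ', Finset.Nat.sum_antidiagonal_succ]
    simp only [hN_succ hq1, eN_succ hq1, pow_zero, sub_self, mul_zero, zero_mul, zero_add]
    rw [← Finset.sum_add_distrib, Finset.mul_sum]
    refine Finset.sum_congr rfl fun p hp => ?_
    rw [HasAntidiagonal.mem_antidiagonal] at hp
    rw [← hp, pow_add]
    ring

lemma conv_eh {q : K} (hq1 : ∀ k : ℕ, q ^ (k + 1) ≠ 1) (a b : K) (z : ℤ) :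
    convZ (extZ (eN b q)) (extZ (hN a q)) z = extZ (gN a b q) z := by
  unfold convZ
  conv_rhs => unfold extZ
  split_ifs
  · rw [← qbinomial hq1]
    exact Finset.sum_congr rfl fun p _ => by rw [extZ_nat, extZ_nat]
  · rfl

lemma conv_dual {q : K} (hq1 : ∀ k : ℕ, q ^ (k + 1) ≠ 1) (b : K) (z : ℤ) :
    convZ (extZ (eN b q)) (fun z => (-1) ^ z.natAbs * extZ (hN b q) z) z =
      if z = 0 then 1 else 0 := by
  have e : (fun z : ℤ => (-1) ^ z.natAbs * extZ (hN b q) z) = extZ (hN (-b) q) := by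
    funext z
    unfold extZ
    split_ifs with h
    · have : z.natAbs = z.toNat := by omega
      rw [this]
      unfold hN
      rw [neg_pow b]
      ring
    · simp
  rw [e, conv_eh hq1]
  unfold extZ
  rcases lt_trichotomy z 0 with h | h | h
  · rw [if_neg (by omega), if_neg (by omega)]
  · subst h; simp [gN, qp]
  · rw [if_pos h.le, if_neg (by omega)]
    unfold gN
    rw [Finset.prod_eq_zero (i := 0), zero_div]
    · simp; omega
    · simp

/-- The polynomials in `X = q^{λ_i - i}`. -/
noncomputable def pP (a b q : K) (n j : ℕ) : Polynomial K :=
  (∏ t ∈ range j, (Polynomial.C a + Polynomial.C (b * q ^ t) * Polynomial.X)) *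
    ∏ s ∈ Ico (j + 1) n, (1 - Polynomial.C (q ^ s) * Polynomial.X)

lemma pP_eval (a b q : K) (n j : ℕ) (x : K) : (pP a b q n j).eval x =
    (∏ t ∈ range j, (a + b * q ^ t * x)) * ∏ s ∈ Ico (j + 1) n, (1 - q ^ s * x) := by
  simp [pP, Polynomial.eval_prod]

lemma pP_natDegree (a b q : K) (n j : ℕ) (hj : j < n) : (pP a b q n j).natDegree < n := by
  have h1 : (∏ t ∈ range j,
      (Polynomial.C a + Polynomial.C (b * q ^ t) * Polynomial.X)).natDegree ≤ j := by
    refine (Polynomial.natDegree_prod_le _ _).trans ?_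
    refine (Finset.sum_le_card_nsmul _ _ 1 fun t _ => ?_).trans (by simp)
    compute_degree
  have h2 : (∏ s ∈ Ico (j + 1) n,
      ((1 : Polynomial K) - Polynomial.C (q ^ s) * Polynomial.X)).natDegree ≤ n - (j + 1) := by
    refine (Polynomial.natDegree_prod_le _ _).trans ?_
    refine (Finset.sum_le_card_nsmul _ _ 1 fun t _ => ?_).trans (by simp)
    compute_degree
  have := Polynomial.natDegree_mul_le_of_le h1 h2
  unfold pP
  omega

lemma pP_det (a b q : K) (n : ℕ) : ∃ c : K, ∀ v : Fin n → K,
    (Matrix.of fun i j : Fin n => (pP a b q n j).eval (v i)).det =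
      (Matrix.vandermonde v).det * c := by
  refine ⟨(Matrix.of fun k j : Fin n => (pP a b q n j).coeff k).det, fun v => ?_⟩
  rw [← Matrix.det_mul]
  congr 1
  ext i j
  rw [Matrix.mul_apply, Matrix.of_apply,
    Polynomial.eval_eq_sum_range' (pP_natDegree a b q n j j.2), Finset.sum_range]
  exact Finset.sum_congr rfl fun k _ => by simp [mul_comm]

lemma row_eq {a b q : K} (hq : q ≠ 0) (hq1 : ∀ k : ℕ, q ^ (k + 1) ≠ 1) (n i j l : ℕ)
    (hi : i < n) (hj : j < n) :
    extZ (gN a b q) ((l : ℤ) - i + j) * ∏ t ∈ range i, (a + b * q ^ ((t : ℤ) - i)) =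
    (∏ t ∈ range l, (a + b * q ^ ((t : ℤ) - i))) / qp q (l + (n - 1 - i)) *
      (pP a b q n j).eval (q ^ ((l : ℤ) - i)) := by
  rw [pP_eval]
  by_cases h : i ≤ l + j
  · obtain ⟨m, hm⟩ := Nat.exists_eq_add_of_le h
    have e : (l : ℤ) - i + j = (m : ℕ) := by omega
    rw [e, extZ_nat]
    have h1 : (∏ t ∈ range i, (a + b * q ^ ((t : ℤ) - i))) * ∏ t ∈ range m, (a + b * q ^ t) =
        (∏ t ∈ range l, (a + b * q ^ ((t : ℤ) - i))) *
        ∏ t ∈ range j, (a + b * q ^ t * q ^ ((l : ℤ) - i)) := by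
      have a1 := Finset.prod_range_add (fun t : ℕ => (a + b * q ^ ((t : ℤ) - i))) i m
      have a2 := Finset.prod_range_add (fun t : ℕ => (a + b * q ^ ((t : ℤ) - i))) l j
      rw [hm, a1] at a2
      convert a2 using 2
      · refine Finset.prod_congr rfl fun t _ => ?_
        rw [← zpow_natCast]
        congr 3
        push_cast; ring
      · refine Finset.prod_congr rfl fun t _ => ?_
        rw [← zpow_natCast, mul_assoc, ← zpow_add₀ hq]
        congr 3
        push_cast; ring
    have h2 : qp q (l + (n - 1 - i)) =
        qp q m * ∏ s ∈ Ico (j + 1) n, (1 - q ^ s * q ^ ((l : ℤ) - i)) := by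
      have e2 : l + (n - 1 - i) = m + (n - (j + 1)) := by omega
      rw [e2]
      unfold qp
      rw [Finset.prod_range_add, Finset.prod_Ico_eq_prod_range]
      congr 1
      refine Finset.prod_congr rfl fun t _ => ?_
      rw [← zpow_natCast, ← zpow_natCast, ← zpow_add₀ hq]
      congr 2
      push_cast; omega
    have h3 := qp_ne_zero hq1 (l + (n - 1 - i))
    have h4 := qp_ne_zero hq1 m
    unfold gN
    rw [div_mul_eq_mul_div, mul_comm (∏ t ∈ range m, _), h1, div_mul_eq_mul_div,
      div_eq_div_iff h4 h3, h2]
    ring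
  · rw [extZ_neg _ _ (by omega), zero_mul, Finset.prod_eq_zero (i := i - l) (s := Ico (j + 1) n)]
    · simp
    · simp; omega
    · rw [← zpow_natCast, ← zpow_add₀ hq]
      have : ((i - l : ℕ) : ℤ) + (l - i) = 0 := by omega
      rw [this]; simp

lemma prod_fin_lt {M : Type*} [CommMonoid M] (n l : ℕ) (hl : l ≤ n) (f : ℕ → M) :
    ∏ j ∈ univ.filter (fun j : Fin n => (j : ℕ) < l), f j = ∏ t ∈ range l, f t := by
  rw [Finset.prod_filter, Fin.prod_univ_eq_prod_range (fun j => if j < l then f j else 1),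
    ← Finset.prod_filter]
  refine Finset.prod_congr ?_ fun _ _ => rfl
  ext t
  simp
  omega

lemma hook_row (q : K) {n : ℕ} {lam : Fin n → ℕ} (h : Antitone lam) (hn : ∀ i, lam i ≤ n)
    (i : Fin n) :
    qp q (lam i + (n - 1 - i)) =
      (∏ j ∈ Ioi i, (1 - q ^ (posFun n lam (Sum.inl i) - posFun n lam (Sum.inl j)))) *
      ∏ j ∈ univ.filter (fun j : Fin n => (j : ℕ) < lam i),
        (1 - q ^ (posFun n lam (Sum.inl i) - posFun n lam (Sum.inr j))) := by
  set L := lam i + (n - 1 - i) with hL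
  have hLp : posFun n lam (Sum.inl i) = L := rfl
  have hLn : L ≤ n + n := by have := hn i; omega
  have h1 : qp q L = ∏ y ∈ univ.filter (fun y : Fin (n + n) => (y : ℕ) < L),
      (1 - q ^ (L - (y : ℕ))) := by
    rw [prod_fin_lt (n + n) L hLn (fun y => 1 - q ^ (L - y))]
    unfold qp
    rw [← Finset.prod_range_reflect]
    refine Finset.prod_congr rfl fun t ht => ?_
    rw [mem_range] at ht
    congr 2
    omega
  rw [h1, Finset.prod_filter, ← (posEquiv n lam h hn).prod_comp, Fintype.prod_sum_type]
  simp only [posEquiv_val]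
  rw [← hLp]
  simp only [posFun_inl_lt h, posFun_inr_lt_inl h]
  rw [← Finset.prod_filter, ← Finset.prod_filter]
  congr 2
  ext j; simp

lemma gdet {a b q : K} (hq : q ≠ 0) (hq1 : ∀ k : ℕ, q ^ (k + 1) ≠ 1)
    (hab : ∀ z : ℤ, a + b * q ^ z ≠ 0) {n : ℕ} {lam : Fin n → ℕ} (h : Antitone lam)
    (hn : ∀ i, lam i ≤ n) :
    (Matrix.of fun i j : Fin n => extZ (gN a b q) ((lam i : ℤ) - (i : ℤ) + (j : ℤ))).det =
    ∏ i : Fin n, (q ^ ((i : ℕ) * lam i) *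
      ∏ j ∈ univ.filter (fun j : Fin n => (j : ℕ) < lam i),
      ((a + b * q ^ ((j : ℤ) - (i : ℤ))) /
        (1 - q ^ (posFun n lam (Sum.inl i) - posFun n lam (Sum.inr j))))) := by
  obtain ⟨c, hc⟩ := pP_det a b q n
  set U : Fin n → K := fun i => ∏ t ∈ range (i : ℕ), (a + b * q ^ ((t : ℤ) - (i : ℕ))) with hU
  have hU0 : ∀ i, U i ≠ 0 := fun i => Finset.prod_ne_zero_iff.2 fun t _ => hab _
  set Nn : Fin n → K := fun i => ∏ t ∈ range (lam i), (a + b * q ^ ((t : ℤ) - (i : ℕ))) with hNn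
  set v : Fin n → K := fun i => q ^ ((lam i : ℤ) - (i : ℕ)) with hv
  set v0 : Fin n → K := fun i => q ^ (-((i : ℕ) : ℤ)) with hv0
  set W : Fin n → K := fun i => ∏ j ∈ Ioi i,
    (1 - q ^ (posFun n lam (Sum.inl i) - posFun n lam (Sum.inl j))) with hW
  set W0 : Fin n → K := fun i => ∏ j ∈ Ioi i, (1 - q ^ ((j : ℕ) - (i : ℕ))) with hW0
  set Hk : Fin n → K := fun i => ∏ j ∈ univ.filter (fun j : Fin n => (j : ℕ) < lam i),
        (1 - q ^ (posFun n lam (Sum.inl i) - posFun n lam (Sum.inr j))) with hHk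
  set Q : K := ∏ i : Fin n, ∏ j ∈ Ioi i, q ^ (-((j : ℕ) : ℤ)) with hQ
  set Z : K := ∏ i : Fin n, ∏ j ∈ Ioi i, q ^ (lam j) with hZ
  have hQ0 : Q ≠ 0 := Finset.prod_ne_zero_iff.2 fun i _ => Finset.prod_ne_zero_iff.2
    fun j _ => zpow_ne_zero _ hq
  have hpos : ∀ m : ℕ, 0 < m → 1 - q ^ m ≠ 0 := by
    intro m hm
    obtain ⟨k, rfl⟩ := Nat.exists_eq_succ_of_ne_zero hm.ne'
    exact sub_ne_zero.2 (hq1 k).symm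
  have hW00 : ∀ i, W0 i ≠ 0 := fun i => Finset.prod_ne_zero_iff.2 fun j hj => by
    rw [mem_Ioi] at hj
    have : (i : ℕ) < j := hj
    exact hpos _ (by omega)
  have hW_0 : ∀ i, W i ≠ 0 := fun i => Finset.prod_ne_zero_iff.2 fun j hj => by
    rw [mem_Ioi] at hj
    have := (posFun_inl_lt h).2 hj
    exact hpos _ (by omega)
  have hHk0 : ∀ i, Hk i ≠ 0 := fun i => Finset.prod_ne_zero_iff.2 fun j hj => by
    simp only [mem_filter, mem_univ, true_and] at hj
    have := (posFun_inr_lt_inl h).2 hj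
    exact hpos _ (by omega)
  have hrow : ∀ i, qp q (lam i + (n - 1 - i)) = W i * Hk i := fun i => hook_row q h hn i
  -- Vandermonde at v
  have hV : (Matrix.vandermonde v).det = Z * Q * ∏ i, W i := by
    rw [Matrix.det_vandermonde, hZ, hQ, ← Finset.prod_mul_distrib, ← Finset.prod_mul_distrib]
    refine Finset.prod_congr rfl fun i _ => ?_
    rw [hW, ← Finset.prod_mul_distrib, ← Finset.prod_mul_distrib]
    refine Finset.prod_congr rfl fun j hj => ?_
    rw [mem_Ioi] at hj
    have h1 := (posFun_inl_lt h).2 hj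
    have h2 : (i : ℕ) < j := hj
    have h3 := h hj.le
    simp only [posFun, Sum.elim_inl] at h1
    simp only [hv, posFun, Sum.elim_inl]
    rw [mul_sub, mul_one, ← zpow_natCast, ← zpow_natCast, ← zpow_add₀ hq, ← zpow_add₀ hq]
    congr 2
    omega
  have hV0 : (Matrix.vandermonde v0).det = Q * ∏ i, W0 i := by
    rw [Matrix.det_vandermonde, hQ, ← Finset.prod_mul_distrib]
    refine Finset.prod_congr rfl fun i _ => ?_
    rw [hW0, ← Finset.prod_mul_distrib]
    refine Finset.prod_congr rfl fun j hj => ?_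
    rw [mem_Ioi] at hj
    have h2 : (i : ℕ) < j := hj
    simp only [hv0]
    rw [mul_sub, mul_one, ← zpow_natCast, ← zpow_add₀ hq]
    congr 2
    omega
  have hT0 : (Matrix.of fun i j : Fin n => (pP a b q n j).eval (v0 i)).det =
      (∏ i, U i) * ∏ i, W0 i := by
    rw [Matrix.det_of_isUpperTriangular, ← Finset.prod_mul_distrib]
    · refine Finset.prod_congr rfl fun i _ => ?_
      rw [Matrix.of_apply, pP_eval]
      congr 1
      · refine Finset.prod_congr rfl fun t _ => ?_
        simp only [hv0]
        rw [← zpow_natCast, mul_assoc, ← zpow_add₀ hq]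
        congr 3
      · rw [hW0]
        simp only
        have e : Ico ((i : ℕ) + 1) n = (Ioi i).map Fin.valEmbedding := by
          rw [Fin.map_valEmbedding_Ioi]
          ext; simp [Nat.succ_le_iff]
        rw [e, Finset.prod_map]
        refine Finset.prod_congr rfl fun j hj => ?_
        rw [mem_Ioi] at hj
        have h2 : (i : ℕ) < j := hj
        simp only [hv0, Fin.valEmbedding_apply]
        rw [← zpow_natCast, ← zpow_natCast, ← zpow_add₀ hq]
        congr 2
        omega
    · intro i j hij
      have hij' : j < i := hij
      have h2 : (j : ℕ) < i := hij'
      rw [Matrix.of_apply, pP_eval, Finset.prod_eq_zero (i := (i : ℕ)) (s := Ico _ _), mul_zero]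
      · simp; omega
      · simp only [hv0]
        rw [← zpow_natCast, ← zpow_add₀ hq]
        simp
  have hG : (Matrix.of fun i j : Fin n =>
      extZ (gN a b q) ((lam i : ℤ) - (i : ℤ) + (j : ℤ))).det * ∏ i, U i =
      (∏ i, Nn i / (W i * Hk i)) * ((Z * Q * ∏ i, W i) * c) := by
    rw [← hV, ← hc v, mul_comm, ← Matrix.det_mul_column, ← Matrix.det_mul_column]
    congr 1
    ext i j
    simp only [Matrix.of_apply]
    rw [mul_comm, row_eq hq hq1 n i j (lam i) i.2 j.2, hrow]
  have hc0 : Q * (∏ i, W0 i) * c = (∏ i, U i) * ∏ i, W0 i := by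
    rw [← hV0, ← hc v0, hT0]
  have hPU : ∏ i, U i ≠ 0 := Finset.prod_ne_zero_iff.2 fun i _ => hU0 i
  have hPW0 : ∏ i, W0 i ≠ 0 := Finset.prod_ne_zero_iff.2 fun i _ => hW00 i
  have hPW : ∏ i, W i ≠ 0 := Finset.prod_ne_zero_iff.2 fun i _ => hW_0 i
  have hPH : ∏ i, Hk i ≠ 0 := Finset.prod_ne_zero_iff.2 fun i _ => hHk0 i
  have hc1 : Q * c = ∏ i, U i := by
    apply mul_right_cancel₀ hPW0
    rw [← hc0]; ring
  have hZ' : Z = ∏ i : Fin n, q ^ ((i : ℕ) * lam i) := by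
    rw [hZ, Finset.prod_comm' (s' := fun j : Fin n => Finset.Iio j) (t' := univ) (by simp)]
    refine Finset.prod_congr rfl fun j _ => ?_
    rw [Finset.prod_const, Fin.card_Iio, ← pow_mul, mul_comm]
  have hfin : (Matrix.of fun i j : Fin n =>
      extZ (gN a b q) ((lam i : ℤ) - (i : ℤ) + (j : ℤ))).det = Z * ∏ i, (Nn i / Hk i) := by
    apply mul_right_cancel₀ hPU
    rw [hG, ← hc1, Finset.prod_div_distrib, Finset.prod_div_distrib, Finset.prod_mul_distrib]
    field_simp
  rw [hfin, hZ', ← Finset.prod_mul_distrib]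
  refine Finset.prod_congr rfl fun i _ => ?_
  congr 1
  rw [Finset.prod_div_distrib, hNn, hHk]
  simp only
  rw [prod_fin_lt n (lam i) (hn i) (fun t => a + b * q ^ ((t : ℤ) - (i : ℕ)))]

end QSeries

lemma ch_succ {R : Type*} [CommRing R] (N : ℕ) (w : Fin (N + 1) → R) (k : ℕ) :
    completeHomogeneous (N + 1) w k = ∑ p ∈ antidiagonal k,
      w 0 ^ p.1 * completeHomogeneous N (fun i => w i.succ) p.2 := by
  unfold completeHomogeneous
  simp_rw [Finset.mul_sum]
  rw [Finset.sum_sigma']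
  refine Finset.sum_bij' (fun d _ => ⟨(d 0, ∑ i : Fin N, d i.succ), fun i => d i.succ⟩)
    (fun x _ => Fin.cons x.1.1 x.2) ?_ ?_ ?_ ?_ ?_
  · intro d hd
    rw [Finset.Nat.mem_antidiagonalTuple, Fin.sum_univ_succ] at hd
    simp [Finset.Nat.mem_antidiagonalTuple, hd]
  · rintro ⟨⟨x, y⟩, d⟩ h
    simp [Finset.Nat.mem_antidiagonalTuple] at h
    simp [Finset.Nat.mem_antidiagonalTuple, Fin.sum_univ_succ, h]
  · intro d hd
    funext i
    refine Fin.cases ?_ (fun i => ?_) i <;> simp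
  · rintro ⟨⟨x, y⟩, d⟩ h
    simp [Finset.Nat.mem_antidiagonalTuple] at h
    simp [h]
  · intro d hd
    rw [Fin.prod_univ_succ]

lemma ch_scale {R : Type*} [CommRing R] (N : ℕ) (w : Fin N → R) (q : R) (k : ℕ) :
    completeHomogeneous N (fun i => q * w i) k = q ^ k * completeHomogeneous N w k := by
  unfold completeHomogeneous
  rw [Finset.mul_sum]
  refine Finset.sum_congr rfl fun d hd => ?_
  rw [Finset.Nat.mem_antidiagonalTuple] at hd
  simp_rw [mul_pow]
  rw [Finset.prod_mul_distrib, Finset.prod_pow_eq_pow_sum, hd]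

lemma ch_rec {R : Type*} [CommRing R] (a q : R) (N k : ℕ) :
    completeHomogeneous (N + 1) (fun i => a * q ^ (i : ℕ)) (k + 1) =
    a * completeHomogeneous (N + 1) (fun i => a * q ^ (i : ℕ)) k +
    q ^ (k + 1) * completeHomogeneous N (fun i => a * q ^ (i : ℕ)) (k + 1) := by
  have e : (fun i : Fin N => a * q ^ ((i.succ : Fin (N + 1)) : ℕ)) =
      fun i : Fin N => q * (a * q ^ (i : ℕ)) := by
    funext i
    rw [Fin.val_succ, pow_succ]; ring
  rw [ch_succ, ch_succ, Finset.Nat.sum_antidiagonal_succ, Finset.mul_sum, add_comm]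
  simp only [e, ch_scale, Fin.val_zero, pow_zero, mul_one, one_mul]
  congr 1
  exact Finset.sum_congr rfl fun p _ => by ring

lemma ch_zero {R : Type*} [CommRing R] (N : ℕ) (w : Fin N → R) :
    completeHomogeneous N w 0 = 1 := by
  simp [completeHomogeneous, Finset.Nat.antidiagonalTuple_zero_right]

lemma ch_closed {K : Type*} [Field K] {q : K} (hq1 : ∀ k : ℕ, q ^ (k + 1) ≠ 1) (a : K) (N : ℕ) :
    ∀ k, completeHomogeneous N (fun i => a * q ^ (i : ℕ)) k =
      hN a q k * ∏ t ∈ range k, (1 - q ^ t * q ^ N) := by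
  induction N with
  | zero =>
    intro k
    cases k with
    | zero => simp [ch_zero, hN, qp]
    | succ k =>
      rw [Finset.prod_eq_zero (i := 0) (by simp) (by simp)]
      simp [completeHomogeneous]
  | succ N ihN =>
    intro k
    induction k with
    | zero => simp [ch_zero, hN, qp]
    | succ k ihk =>
      have h2 : 1 - q ^ (k + 1) ≠ 0 := sub_ne_zero.2 (hq1 k).symm
      rw [ch_rec, ihk, ihN, ← mul_assoc, ← hN_succ hq1]
      rw [Finset.prod_range_succ' (fun t => 1 - q ^ t * q ^ N), Finset.prod_range_succ]
      have e : ∏ t ∈ range k, (1 - q ^ (t + 1) * q ^ N) =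
          ∏ t ∈ range k, (1 - q ^ t * q ^ (N + 1)) :=
        Finset.prod_congr rfl fun t _ => by ring
      rw [e]
      ring

/-- The polynomial whose value at `q^N` is `h_z(a, …, a q^{N-1})`. -/
noncomputable def HPz {K : Type*} [Field K] (a q : K) (z : ℤ) : Polynomial K :=
  if 0 ≤ z then Polynomial.C (hN a q z.toNat) *
    ∏ t ∈ range z.toNat, (1 - Polynomial.C (q ^ t) * Polynomial.X) else 0

lemma HPz_eval {K : Type*} [Field K] {q : K} (hq1 : ∀ k : ℕ, q ^ (k + 1) ≠ 1) (a : K) (N : ℕ)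
    (z : ℤ) : completeHomogeneousZ N (fun i => a * q ^ (i : ℕ)) z =
      Polynomial.evalRingHom (q ^ N) (HPz a q z) := by
  unfold completeHomogeneousZ HPz
  split_ifs
  · rw [ch_closed hq1]
    simp [Polynomial.eval_prod]
  · simp

lemma HPz_eval_zero {K : Type*} [Field K] (a q : K) (z : ℤ) :
    Polynomial.evalRingHom 0 (HPz a q z) = extZ (hN a q) z := by
  unfold extZ HPz
  split_ifs
  · simp [Polynomial.eval_prod]
  · simp

/-- The polynomial whose value at `q^N` is the truncated super Schur function. -/
noncomputable def superPoly {K : Type*} [Field K] (a b q : K) (n : ℕ) (lam : Fin n → ℕ) :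
    Polynomial K :=
  ∑ mu ∈ (Fintype.piFinset fun i : Fin n => Finset.range (lam i + 1)).filter
      (fun mu => Antitone mu),
      (Matrix.of fun i j : Fin n =>
        HPz a q ((mu i : ℤ) - (((0 : Fin n → ℕ) j : ℕ) : ℤ) - (i : ℤ) + (j : ℤ))).det *
      (Matrix.of fun i j : Fin n => HPz b q ((conjTuple n lam n i : ℤ) -
        (conjTuple n mu n j : ℤ) - (i : ℤ) + (j : ℤ))).det

lemma superPoly_eval {K : Type*} [Field K] {q : K} (hq1 : ∀ k : ℕ, q ^ (k + 1) ≠ 1) (a b : K)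
    (n : ℕ) (lam : Fin n → ℕ) (N : ℕ) :
    superSchur N N n (fun i => a * q ^ (i : ℕ)) (fun j => b * q ^ (j : ℕ)) lam =
      (superPoly a b q n lam).eval (q ^ N) := by
  rw [← Polynomial.coe_evalRingHom]
  unfold superPoly superSchur skewSchur
  rw [map_sum]
  refine Finset.sum_congr rfl fun mu _ => ?_
  rw [map_mul, RingHom.map_det, RingHom.map_det]
  congr 2
  · ext i j
    exact HPz_eval hq1 a N _
  · ext i j
    exact HPz_eval hq1 b N _

lemma superPoly_zero {K : Type*} [Field K] {a b q : K} (hq : q ≠ 0)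
    (hq1 : ∀ k : ℕ, q ^ (k + 1) ≠ 1)
    (hab : ∀ z : ℤ, a + b * q ^ z ≠ 0) {n : ℕ} {lam : Fin n → ℕ} (h : Antitone lam)
    (hn : ∀ i, lam i ≤ n) :
    (superPoly a b q n lam).eval 0 =
    ∏ i : Fin n, (q ^ ((i : ℕ) * lam i) *
      ∏ j ∈ univ.filter (fun j : Fin n => (j : ℕ) < lam i),
      ((a + b * q ^ ((j : ℤ) - (i : ℤ))) /
        (1 - q ^ (posFun n lam (Sum.inl i) - posFun n lam (Sum.inr j))))) := by
  rw [← gdet hq hq1 hab h hn]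
  simp_rw [← conv_eh hq1]
  rw [← super_det (extZ (hN a q)) (extZ (hN b q)) (extZ (eN b q)) (extZ_neg _) (extZ_neg _)
    (extZ_neg _) (by simp [extZ, eN, qp]) (conv_dual hq1 b) h hn]
  rw [← Polynomial.coe_evalRingHom]
  unfold superPoly
  rw [map_sum]
  refine Finset.sum_congr rfl fun mu _ => ?_
  rw [map_mul, RingHom.map_det, RingHom.map_det]
  congr 2
  · ext i j
    exact HPz_eval_zero a q _
  · ext i j
    exact HPz_eval_zero b q _

lemma qL_pow (k : ℕ) : qL ^ k = HahnSeries.single (k : ℤ) (1 : FF) := by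
  unfold qL
  rw [HahnSeries.single_pow]
  simp

lemma qL_ne_zero : qL ≠ 0 := by
  unfold qL
  simp

lemma qL_zpow (z : ℤ) : qL ^ z = HahnSeries.single z (1 : FF) := by
  obtain ⟨k, rfl | rfl⟩ := z.eq_nat_or_neg
  · rw [zpow_natCast, qL_pow]
  · rw [zpow_neg, zpow_natCast, qL_pow, HahnSeries.inv_single]
    simp

lemma qL_pow_ne_one (k : ℕ) : qL ^ (k + 1) ≠ 1 := by
  rw [qL_pow]
  intro e
  have := congrArg (fun s => HahnSeries.coeff s (0 : ℤ)) e
  simp only [HahnSeries.coeff_one, if_true] at this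
  rw [HahnSeries.coeff_single_of_ne (by omega)] at this
  exact zero_ne_one this

lemma ab_ne_zero (z : ℤ) : aL + bL * qL ^ z ≠ 0 := by
  rw [qL_zpow]
  intro e
  have e0 := congrArg (fun s => HahnSeries.coeff s (0 : ℤ)) e
  unfold aL bL at e0
  simp only [HahnSeries.coeff_add, HahnSeries.coeff_zero, HahnSeries.C_apply,
    HahnSeries.single_mul_single, zero_add, mul_one, HahnSeries.coeff_single_same] at e0
  have inj := IsFractionRing.injective (MvPolynomial (Fin 2) ℚ) FF
  by_cases hz : z = 0
  · subst hz
    rw [HahnSeries.coeff_single_same, ← map_add, ← map_zero (algebraMap (MvPolynomial (Fin 2) ℚ) FF)] at e0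
    have e1 := congrArg (MvPolynomial.eval (fun _ => (1 : ℚ))) (inj e0)
    simp at e1
  · rw [HahnSeries.coeff_single_of_ne (Ne.symm hz), add_zero,
      ← map_zero (algebraMap (MvPolynomial (Fin 2) ℚ) FF)] at e0
    exact MvPolynomial.X_ne_zero _ (inj e0)

lemma poly_limit (P : Polynomial (LaurentSeries FF)) (z : ℤ) : ∃ N₀ : ℕ, ∀ N ≥ N₀,
    (P.eval (qL ^ N)).coeff z = (P.eval 0).coeff z := by
  induction P using Polynomial.induction_on' with
  | add p r hp hr =>
    obtain ⟨N1, h1⟩ := hp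
    obtain ⟨N2, h2⟩ := hr
    refine ⟨max N1 N2, fun N hN => ?_⟩
    rw [Polynomial.eval_add, Polynomial.eval_add, HahnSeries.coeff_add, HahnSeries.coeff_add,
      h1 N (le_trans (le_max_left _ _) hN), h2 N (le_trans (le_max_right _ _) hN)]
  | monomial k c =>
    cases k with
    | zero => exact ⟨0, fun N _ => by simp⟩
    | succ k =>
      refine ⟨(z - c.order).toNat + 1, fun N hN => ?_⟩
      rw [Polynomial.eval_monomial, Polynomial.eval_monomial, ← pow_mul, qL_pow]
      have e : z = (z - ((N * (k + 1) : ℕ) : ℤ)) + ((N * (k + 1) : ℕ) : ℤ) := by ring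
      conv_lhs => rw [e, HahnSeries.coeff_mul_single_add]
      rw [HahnSeries.coeff_eq_zero_of_lt_order]
      · simp
      · have : N ≤ N * (k + 1) := Nat.le_mul_of_pos_right _ (by omega)
        omega

/-- **Principal specialization of the super Schur function**: for a partition `λ` of `n`
(a weakly decreasing tuple `Fin n → ℕ` summing to `n`),
`hs_λ(a, aq, aq², … ; b, bq, bq², …) = q^{n(λ)} ∏_{□∈λ} (a + b q^{c_□})/(1 - q^{h_□})`,
where `c_□ = j - i` is the content and `h_□` the hook length of the cell `□ = (i,j)`.
The infinite specialization is interpreted as the coefficientwise limit of the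
truncations `x = (a, aq, …, aq^{N-1})`, `y = (b, bq, …, bq^{N-1})` as `N → ∞`, as an
identity of formal Laurent series in `q` over the field `ℚ(a,b)`. -/
theorem superSchur_principal_specialization (n : ℕ) (lam : Fin n → ℕ)
    (hanti : Antitone lam) (hsum : ∑ i, lam i = n) :
    ∀ z : ℤ, ∃ N₀ : ℕ, ∀ N ≥ N₀,
      (superSchur N N n (fun i => aL * qL ^ (i : ℕ)) (fun j => bL * qL ^ (j : ℕ))
          lam).coeff z =
      (qL ^ (∑ c ∈ (Finset.univ.filter
              fun c : Fin n × Fin n => (c.2 : ℕ) < lam c.1), (c.1 : ℕ)) *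
        ∏ c ∈ (Finset.univ.filter fun c : Fin n × Fin n => (c.2 : ℕ) < lam c.1),
          (aL + bL * qL ^ ((c.2 : ℤ) - (c.1 : ℤ))) /
            (1 - qL ^ ((lam c.1 : ℤ) - (c.2 : ℤ) +
              (conjTuple n lam n c.2 : ℤ) - (c.1 : ℤ) - 1))).coeff z := by
  have hn : ∀ i, lam i ≤ n := fun i => by
    rw [← hsum]
    exact Finset.single_le_sum (fun _ _ => Nat.zero_le _) (mem_univ i)
  have key := superPoly_zero qL_ne_zero qL_pow_ne_one ab_ne_zero hanti hn
  have hR : (qL ^ (∑ c ∈ (Finset.univ.filter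
              fun c : Fin n × Fin n => (c.2 : ℕ) < lam c.1), (c.1 : ℕ)) *
        ∏ c ∈ (Finset.univ.filter fun c : Fin n × Fin n => (c.2 : ℕ) < lam c.1),
          (aL + bL * qL ^ ((c.2 : ℤ) - (c.1 : ℤ))) /
            (1 - qL ^ ((lam c.1 : ℤ) - (c.2 : ℤ) +
              (conjTuple n lam n c.2 : ℤ) - (c.1 : ℤ) - 1))) =
      (superPoly aL bL qL n lam).eval 0 := by
    rw [key, Finset.prod_mul_distrib]
    congr 1
    · rw [Finset.prod_pow_eq_pow_sum]
      congr 1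
      rw [Finset.sum_filter, Fintype.sum_prod_type]
      refine Finset.sum_congr rfl fun i _ => ?_
      simp only
      rw [← Finset.sum_filter, Finset.sum_const, Fin.card_filter_val_lt, min_eq_right (hn i),
        smul_eq_mul, mul_comm]
    · rw [Finset.prod_filter, Fintype.prod_prod_type]
      refine Finset.prod_congr rfl fun i _ => ?_
      simp only
      rw [← Finset.prod_filter]
      refine Finset.prod_congr rfl fun j hj => ?_
      simp only [mem_filter, mem_univ, true_and] at hj
      have h1 := (posFun_inr_lt_inl hanti).2 hj
      have h2 := conj_le n lam j
      have e : (lam i : ℤ) - (j : ℤ) + (conjTuple n lam n j : ℤ) - (i : ℤ) - 1 =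
          ((posFun n lam (Sum.inl i) - posFun n lam (Sum.inr j) : ℕ) : ℤ) := by
        simp only [posFun, Sum.elim_inl, Sum.elim_inr] at h1 ⊢
        omega
      rw [e, zpow_natCast]
  intro z
  obtain ⟨N₀, hN⟩ := poly_limit (superPoly aL bL qL n lam) z
  refine ⟨N₀, fun N hNN => ?_⟩
  rw [hR, superPoly_eval qL_pow_ne_one, hN N hNN]
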